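/- A factor of a Sturmian word has exactly two abelian returns if and only if it is singular. -/

import Mathlib

variable {α : Type*}

/-- The factor of the infinite word `w` of length `n` starting at position `i`. -/
def factorAt (w : ℕ → α) (i n : ℕ) : List α :=
  (List.range n).map fun k => w (i + k)

/-- `u` is a factor of the infinite word `w`. -/
def IsFactor (w : ℕ → α) (u : List α) : Prop :=
  ∃ i, factorAt w i u.length = u

/-- `w` is recurrent: each of its factors occurs infinitely many times. -/
def Recurrent (w : ℕ → α) : Prop :=
  ∀ u : List α, IsFactor w u → ∀ N : ℕ, ∃ i, N ≤ i ∧ factorAt w i u.length = u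

/-- `w` is periodic: there is `T > 0` with `w (n + T) = w n` for all `n`. -/
def Periodic (w : ℕ → α) : Prop :=
  ∃ T : ℕ, 0 < T ∧ ∀ n, w (n + T) = w n

def Aperiodic (w : ℕ → α) : Prop := ¬ Periodic w

def UltimatelyPeriodic (w : ℕ → α) : Prop :=
  ∃ N T : ℕ, 0 < T ∧ ∀ n, N ≤ n → w (n + T) = w n

/-- `w` is Sturmian: aperiodic with subword complexity `n + 1`. -/
def Sturmian (w : ℕ → α) : Prop :=
  Aperiodic w ∧ ∀ n : ℕ, {u : List α | u.length = n ∧ IsFactor w u}.ncard = n + 1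

/-- Positions where `u` occurs in `w`. -/
def Occurrences (w : ℕ → α) (u : List α) : Set ℕ :=
  {i | factorAt w i u.length = u}

/-- The return words of `u` in `w`: words from one occurrence of `u` to the next. -/
def ReturnWords (w : ℕ → α) (u : List α) : Set (List α) :=
  {r | ∃ i j : ℕ, i ∈ Occurrences w u ∧ j ∈ Occurrences w u ∧ i < j ∧
    (∀ k, i < k → k < j → k ∉ Occurrences w u) ∧ r = factorAt w i (j - i)}

/-- Positions where a word abelian-equivalent to `u` occurs in `w`. -/
def AbelianOccurrences (w : ℕ → α) (u : List α) : Set ℕ :=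
  {i | List.Perm (factorAt w i u.length) u}

/-- The abelian return words of `u` in `w`. -/
def AbelianReturnWords (w : ℕ → α) (u : List α) : Set (List α) :=
  {r | ∃ i j : ℕ, i ∈ AbelianOccurrences w u ∧ j ∈ AbelianOccurrences w u ∧ i < j ∧
    (∀ k, i < k → k < j → k ∉ AbelianOccurrences w u) ∧ r = factorAt w i (j - i)}

/-- The abelian equivalence classes (as multisets) of the abelian return words of `u` in `w`. -/
def abelianReturnClasses (w : ℕ → α) (u : List α) : Set (Multiset α) :=
  (fun r : List α => (r : Multiset α)) '' AbelianReturnWords w u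

def RightSpecial (w : ℕ → α) (u : List α) : Prop :=
  ∃ a b : α, a ≠ b ∧ IsFactor w (u ++ [a]) ∧ IsFactor w (u ++ [b])

def LeftSpecial (w : ℕ → α) (u : List α) : Prop :=
  ∃ a b : α, a ≠ b ∧ IsFactor w (a :: u) ∧ IsFactor w (b :: u)

def Bispecial (w : ℕ → α) (u : List α) : Prop :=
  RightSpecial w u ∧ LeftSpecial w u

/-- A factor is singular if it is the only factor of `w` in its abelian class. -/
def Singular (w : ℕ → α) (u : List α) : Prop :=
  ∀ v : List α, IsFactor w v → List.Perm v u → v = u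

/-- `w` is an infinite concatenation of words from `S`. -/
def InfConcat (S : Set (List α)) (w : ℕ → α) : Prop :=
  ∃ f : ℕ → List α, (∀ n, f n ∈ S) ∧
    ∀ n, factorAt w (((List.range n).map fun k => (f k).length).sum) (f n).length = f n

/-- A finite binary word is balanced if any two factors of equal length have numbers
of occurrences of `true` differing by at most one. -/
def BalancedList (w : List Bool) : Prop :=
  ∀ u v : List Bool, u <:+: w → v <:+: w → u.length = v.length →
    |(u.count true : ℤ) - (v.count true : ℤ)| ≤ 1

theorem factorAt_length (w : ℕ → α) (i n : ℕ) : (factorAt w i n).length = n := by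
  simp [factorAt]

theorem factorAt_eq_iff {w : ℕ → α} {i j n : ℕ} :
    factorAt w i n = factorAt w j n ↔ ∀ k < n, w (i + k) = w (j + k) := by
  simp [factorAt]

theorem factorAt_add (w : ℕ → α) (i m n : ℕ) :
    factorAt w i (m + n) = factorAt w i m ++ factorAt w (i + m) n := by
  simp [factorAt, List.range_add, add_assoc]

theorem factorAt_succ_eq_iff {w : ℕ → α} {i j n : ℕ} :
    factorAt w i (n + 1) = factorAt w j (n + 1) ↔
      factorAt w i n = factorAt w j n ∧ w (i + n) = w (j + n) := by
  simp only [factorAt_eq_iff, Nat.lt_succ_iff_lt_or_eq]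
  exact ⟨fun h => ⟨fun k hk => h k (.inl hk), h n (.inr rfl)⟩,
    fun h k hk => hk.elim (h.1 k) fun e => e ▸ h.2⟩

theorem Sturmian.ncard_range {w : ℕ → α} (hw : Sturmian w) (n : ℕ) :
    (Set.range fun i => factorAt w i n).ncard = n + 1 := by
  rw [← hw.2 n]
  congr 1
  ext u
  constructor
  · rintro ⟨i, rfl⟩
    exact ⟨factorAt_length w i n, i, by rw [factorAt_length]⟩
  · rintro ⟨rfl, i, hi⟩
    exact ⟨i, hi⟩

theorem Sturmian.finite_range {w : ℕ → α} (hw : Sturmian w) (n : ℕ) :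
    (Set.range fun i => factorAt w i n).Finite :=
  Set.finite_of_ncard_pos (by rw [hw.ncard_range]; omega)

/-- A Sturmian word is not ultimately periodic. -/
theorem Sturmian.not_ultimatelyPeriodic {w : ℕ → α} (hw : Sturmian w) :
    ¬ UltimatelyPeriodic w := by
  rintro ⟨N, T, hT, h⟩
  have key : ∀ i, ∃ i' < N + T, ∀ k, w (i + k) = w (i' + k) := by
    intro i
    induction i using Nat.strong_induction_on with
    | _ i ih =>
      by_cases hi : i < N + T
      · exact ⟨i, hi, fun _ => rfl⟩
      · obtain ⟨i', hi', e⟩ := ih (i - T) (by omega)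
        refine ⟨i', hi', fun k => ?_⟩
        rw [← e, ← h (i - T + k) (by omega)]
        congr 1
        omega
  have hsub : (Set.range fun i => factorAt w i (N + T)) ⊆
      (fun i => factorAt w i (N + T)) '' Set.Iio (N + T) := by
    rintro _ ⟨i, rfl⟩
    obtain ⟨i', hi', e⟩ := key i
    exact ⟨i', hi', factorAt_eq_iff.2 fun k _ => (e k).symm⟩
  have h1 := Set.ncard_le_ncard hsub ((Set.finite_Iio _).image _)
  have h2 := Set.ncard_image_le (f := fun i => factorAt w i (N + T)) (Set.finite_Iio (N + T))
  rw [hw.ncard_range] at h1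
  have h3 : (Set.Iio (N + T)).ncard = N + T := by simp [Set.ncard_eq_toFinset_card']
  omega

/-- A Sturmian word has a right special factor of each length. -/
theorem Sturmian.exists_special {w : ℕ → α} (hw : Sturmian w) (n : ℕ) :
    ∃ x y, factorAt w x n = factorAt w y n ∧ w (x + n) ≠ w (y + n) := by
  by_contra! h
  have hle : (Set.range fun i => factorAt w i (n + 1)).ncard ≤
      (Set.range fun i => factorAt w i n).ncard := by
    refine Set.ncard_le_ncard_of_injOn (List.take n) ?_ ?_ (hw.finite_range n)
    · rintro _ ⟨i, rfl⟩
      exact ⟨i, by simp [factorAt_add, factorAt_length]⟩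
    · rintro _ ⟨i, rfl⟩ _ ⟨j, rfl⟩ e
      have e' : factorAt w i n = factorAt w j n := by
        simpa [factorAt_add, factorAt_length] using e
      exact factorAt_succ_eq_iff.2 ⟨e', h i j e'⟩
  rw [hw.ncard_range, hw.ncard_range] at hle
  omega

/-- A Sturmian word has at most one right special factor of each length. -/
theorem Sturmian.special_unique {w : ℕ → α} (hw : Sturmian w) {n x x' y y' : ℕ}
    (hx : factorAt w x n = factorAt w x' n) (hx' : w (x + n) ≠ w (x' + n))
    (hy : factorAt w y n = factorAt w y' n) (hy' : w (y + n) ≠ w (y' + n)) :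
    factorAt w x n = factorAt w y n := by
  by_contra hxy
  set F := Set.range fun i => factorAt w i (n + 1)
  set p := factorAt w x' (n + 1)
  set q := factorAt w y' (n + 1)
  have hpq : p ≠ q := fun e => hxy (by rw [hx, hy]; exact (factorAt_succ_eq_iff.1 e).1)
  have hsub : (Set.range fun i => factorAt w i n) ⊆ List.take n '' (F \ {p, q}) := by
    have mem : ∀ z, factorAt w z (n + 1) ≠ p → factorAt w z (n + 1) ≠ q →
        factorAt w z n ∈ List.take n '' (F \ {p, q}) := fun z h1 h2 =>
      ⟨_, ⟨⟨z, rfl⟩, by simp [h1, h2]⟩, by simp [factorAt_add, factorAt_length]⟩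
    rintro _ ⟨z, rfl⟩
    by_cases h1 : factorAt w z (n + 1) = p
    · have : factorAt w z n = factorAt w x n := by rw [hx, (factorAt_succ_eq_iff.1 h1).1]
      simp only [this]
      exact mem x (fun e => hx' (factorAt_succ_eq_iff.1 e).2)
        fun e => hxy (by rw [hy, (factorAt_succ_eq_iff.1 e).1])
    · by_cases h2 : factorAt w z (n + 1) = q
      · have : factorAt w z n = factorAt w y n := by rw [hy, (factorAt_succ_eq_iff.1 h2).1]
        simp only [this]
        exact mem y (fun e => hxy (by rw [hx, (factorAt_succ_eq_iff.1 e).1]))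
          fun e => hy' (factorAt_succ_eq_iff.1 e).2
      · exact mem z h1 h2
  have hF : F.Finite := hw.finite_range (n + 1)
  have hpqF : ({p, q} : Set (List α)) ⊆ F := by
    rintro _ (rfl | rfl)
    exacts [⟨x', rfl⟩, ⟨y', rfl⟩]
  have h1 := Set.ncard_le_ncard hsub ((hF.sdiff).image _)
  have h2 := Set.ncard_image_le (f := List.take n) (hF.sdiff (t := {p, q}))
  have h3 := Set.ncard_sdiff_add_ncard_of_subset hpqF hF
  rw [Set.ncard_pair hpq] at h3
  have h4 : F.ncard = n + 1 + 1 := hw.ncard_range (n + 1)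
  rw [hw.ncard_range] at h1
  omega

/-- The number of occurrences of the letter `b` in the factor of length `n` at position `i`. -/
def letterCount (w : ℕ → Bool) (b : Bool) (i n : ℕ) : ℤ := (factorAt w i n).count b

@[simp] theorem letterCount_zero (w : ℕ → Bool) (b : Bool) (i : ℕ) : letterCount w b i 0 = 0 := by
  simp [letterCount, factorAt]

theorem letterCount_add (w : ℕ → Bool) (b : Bool) (i m n : ℕ) :
    letterCount w b i (m + n) = letterCount w b i m + letterCount w b (i + m) n := by
  simp [letterCount, factorAt_add]

theorem letterCount_one (w : ℕ → Bool) (b : Bool) (i : ℕ) :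
    letterCount w b i 1 = if w i = b then 1 else 0 := by
  simp [letterCount, factorAt, List.count_singleton]

theorem letterCount_one_eq_iff {w : ℕ → Bool} {b : Bool} {i j : ℕ} :
    letterCount w b i 1 = letterCount w b j 1 ↔ w i = w j := by
  rw [letterCount_one, letterCount_one]
  cases w i <;> cases w j <;> cases b <;> simp

theorem perm_iff_count_eq {u v : List Bool} (h : u.length = v.length) (b : Bool) :
    List.Perm u v ↔ u.count b = v.count b := by
  refine ⟨fun e => e.count_eq b, fun e => List.perm_iff_count.2 fun c => ?_⟩
  have hu := List.count_not_add_count u b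
  have hv := List.count_not_add_count v b
  by_cases hc : c = b
  · rw [hc, e]
  · obtain rfl : c = !b := by cases b <;> cases c <;> simp_all
    omega

/-- A Sturmian word does not have both `b s b` and `c s c` as factors, for a palindrome `s` and
distinct letters `b`, `c`. -/
theorem Sturmian.not_both_palindromic_extensions {w : ℕ → Bool} (hw : Sturmian w) {l i j : ℕ}
    (hs : factorAt w (i + 1) l = factorAt w (j + 1) l)
    (hpal : ∀ k < l, w (i + 1 + k) = w (i + l - k))
    (hi : w i = true) (hi' : w (i + 1 + l) = true)
    (hj : w j = false) (hj' : w (j + 1 + l) = false) : False := by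
  obtain ⟨x, x', hx, hx'⟩ := hw.exists_special (l + 1)
  have tail : ∀ {l} y y', factorAt w y (l + 1) = factorAt w y' (l + 1) →
      factorAt w (y + 1) l = factorAt w (y' + 1) l := fun y y' e =>
    factorAt_eq_iff.2 fun k hk => by
      simpa [add_assoc, add_comm 1] using factorAt_eq_iff.1 e (k + 1) (by omega)
  have hxs : factorAt w (x + 1) l = factorAt w (i + 1) l :=
    hw.special_unique (tail _ _ hx) (by simpa [add_assoc, add_comm 1] using hx') hs
      (by simp [hi', hj'])
  obtain ⟨p, hp, hp', hpx⟩ : ∃ p, w p = (!w x) ∧ w (p + 1 + l) = (!w x) ∧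
      factorAt w (p + 1) l = factorAt w (i + 1) l := by
    cases hwx : w x
    · exact ⟨i, by simp [hi], by simp [hi'], rfl⟩
    · exact ⟨j, by simp [hj], by simp [hj'], hs.symm⟩
  have hpx' := factorAt_eq_iff.1 hpx
  have hxs' := factorAt_eq_iff.1 hxs
  have avoid : ∀ k ≤ l + 1, factorAt w (p + k) (l + 1) ≠ factorAt w x (l + 1) := by
    intro k hk e
    have e' := factorAt_eq_iff.1 e
    have e0 := e' 0 (by omega)
    rcases Nat.eq_zero_or_pos k with rfl | hk0
    · simp [hp] at e0
    · rcases Nat.lt_or_ge l k with hkl | hkl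
      · obtain rfl : k = l + 1 := by omega
        have : p + (l + 1) = p + 1 + l := by omega
        simp [this, hp'] at e0
      · have e1 := e' (l - k + 1) (by omega)
        have h1 : p + k + (l - k + 1) = p + 1 + l := by omega
        have h2 : x + (l - k + 1) = x + 1 + (l - k) := by omega
        rw [h1, hp', h2, hxs' _ (by omega), hpal _ (by omega)] at e1
        have h3 : i + l - (l - k) = i + 1 + (k - 1) := by omega
        have h4 : p + k + 0 = p + 1 + (k - 1) := by omega
        rw [h3, ← hpx' _ (by omega), ← h4, e0] at e1
        simp at e1
  obtain ⟨k, hk, k', hk', hkk, e⟩ : ∃ k ≤ l + 1, ∃ k' ≤ l + 1, k < k' ∧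
      factorAt w (p + k) (l + 1) = factorAt w (p + k') (l + 1) := by
    by_contra! hne
    have hinj : Set.InjOn (fun k => factorAt w (p + k) (l + 1)) (Set.Iio (l + 2)) := by
      intro a ha b hb hab
      simp only [Set.mem_Iio] at ha hb
      rcases lt_trichotomy a b with h | h | h
      · exact absurd hab (hne a (by omega) b (by omega) h)
      · exact h
      · exact absurd hab.symm (hne b (by omega) a (by omega) h)
    have hsub : insert (factorAt w x (l + 1))
        ((fun k => factorAt w (p + k) (l + 1)) '' Set.Iio (l + 2)) ⊆
        Set.range fun i => factorAt w i (l + 1) := by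
      rintro _ (rfl | ⟨k, -, rfl⟩)
      exacts [⟨x, rfl⟩, ⟨p + k, rfl⟩]
    have h1 := Set.ncard_le_ncard hsub (hw.finite_range _)
    rw [hw.ncard_range, Set.ncard_insert_of_notMem _ ((Set.finite_Iio _).image _),
      hinj.ncard_image] at h1
    · have h3 : (Set.Iio (l + 2)).ncard = l + 2 := by simp [Set.ncard_eq_toFinset_card']
      omega
    · rintro ⟨k, hk, e⟩
      exact avoid k (by simp only [Set.mem_Iio] at hk; omega) e
  have step : ∀ t, factorAt w (p + k + t) (l + 1) = factorAt w (p + k' + t) (l + 1) ∧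
      factorAt w (p + k + t) (l + 1) ≠ factorAt w x (l + 1) := by
    intro t
    induction t using Nat.strong_induction_on with
    | _ t ih =>
      constructor
      · rcases t with _ | t
        · exact e
        · obtain ⟨h1, h2⟩ := ih t (by omega)
          have h3 : w (p + k + t + (l + 1)) = w (p + k' + t + (l + 1)) := by
            by_contra h
            exact h2 (hw.special_unique h1 h hx hx')
          exact tail _ _ (factorAt_succ_eq_iff.2 ⟨h1, h3⟩)
      · by_cases ht : k + t ≤ l + 1
        · rw [add_assoc]
          exact avoid _ ht
        · obtain ⟨h1, h2⟩ := ih (t - (k' - k)) (by omega)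
          have : p + k' + (t - (k' - k)) = p + k + t := by omega
          rw [← this, ← h1]
          exact h2
  refine hw.not_ultimatelyPeriodic ⟨p + k, k' - k, by omega, fun n hn => ?_⟩
  have h := factorAt_eq_iff.1 (step (n - (p + k))).1 0 (by omega)
  have h1 : p + k + (n - (p + k)) + 0 = n := by omega
  have h2 : p + k' + (n - (p + k)) + 0 = n + (k' - k) := by omega
  rw [h1, h2] at h
  exact h.symm

/-- Sturmian words are balanced. -/
theorem Sturmian.letterCount_le {w : ℕ → Bool} (hw : Sturmian w) (n : ℕ) :
    ∀ i j, letterCount w true i n ≤ letterCount w true j n + 1 := by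
  induction n using Nat.strong_induction_on with
  | _ n ih =>
    intro i j
    by_contra! hij
    set c := letterCount w true with hc
    have split : ∀ x k, k ≤ n → c x n = c x k + c (x + k) (n - k) := fun x k hk => by
      rw [hc, ← letterCount_add, Nat.add_sub_cancel' hk]
    have hn : 2 ≤ n := by
      by_contra! h
      interval_cases n
      · simp [hc] at hij
      · simp only [hc, letterCount_one] at hij
        split_ifs at hij <;> omega
    have pre : ∀ k, 1 ≤ k → k < n → c i k = c j k + 1 ∧
        c (i + k) (n - k) = c (j + k) (n - k) + 1 := by
      intro k h1 h2
      have e1 := ih k h2 i j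
      have e2 := ih (n - k) (by omega) (i + k) (j + k)
      rw [split i k h2.le, split j k h2.le] at hij
      omega
    have letters : ∀ x y, c x 1 = c y 1 + 1 → w x = true ∧ w y = false := by
      intro x y h
      simp only [hc, letterCount_one] at h
      cases hx : w x <;> cases hy : w y <;> simp_all
    have succ : ∀ x k, c x (k + 1) = c x k + c (x + k) 1 := fun x k => letterCount_add ..
    have succ' : ∀ x k, c x (k + 1) = c x 1 + c (x + 1) k := fun x k => by
      rw [add_comm k]; exact letterCount_add ..
    obtain ⟨l, rfl⟩ : ∃ l, n = l + 2 := ⟨n - 2, by omega⟩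
    have first := letters i j (by have := (pre 1 le_rfl (by omega)).1; omega)
    have last := letters (i + 1 + l) (j + 1 + l) (by
      have := (pre (l + 1) (by omega) (by omega)).2
      have h : l + 2 - (l + 1) = 1 := by omega
      rw [h] at this
      simpa only [add_assoc, add_comm 1] using this)
    have mid : ∀ k, 1 ≤ k → k ≤ l → w (i + k) = w (j + k) := by
      intro k h1 h2
      refine (letterCount_one_eq_iff (b := true)).1 ?_
      have e1 := (pre k h1 (by omega)).1
      have e2 := (pre (k + 1) (by omega) (by omega)).1
      rw [succ i k, succ j k] at e2
      change c _ _ = c _ _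
      omega
    have sym : ∀ k, 1 ≤ k → k ≤ l + 1 → c j k = c (j + (l + 2 - k)) k := by
      intro k h1 h2
      have e1 := (pre k h1 (by omega)).1
      have e2 := (pre (l + 2 - k) (by omega) (by omega)).2
      have h : l + 2 - (l + 2 - k) = k := by omega
      rw [h] at e2
      have e3 := ih k (by omega) i (j + (l + 2 - k))
      have e4 := ih k (by omega) (i + (l + 2 - k)) j
      change c _ _ ≤ c _ _ + 1 at e3
      change c _ _ ≤ c _ _ + 1 at e4
      omega
    have pal : ∀ k, 1 ≤ k → k ≤ l → w (j + k) = w (j + (l + 1 - k)) := by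
      intro k h1 h2
      refine (letterCount_one_eq_iff (b := true)).1 ?_
      have e1 := sym k h1 (by omega)
      have e2 := sym (k + 1) (by omega) (by omega)
      rw [succ j k, succ' _ k] at e2
      have h : l + 2 - (k + 1) = l + 1 - k := by omega
      have h' : j + (l + 1 - k) + 1 = j + (l + 2 - k) := by omega
      rw [h, h'] at e2
      change c _ _ = c _ _
      omega
    refine hw.not_both_palindromic_extensions (l := l) (i := i) (j := j)
      (factorAt_eq_iff.2 fun k hk => ?_) (fun k hk => ?_) first.1 last.1 first.2 last.2
    · rw [add_assoc, add_assoc]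
      exact mid (1 + k) (by omega) (by omega)
    · have h1 := mid (1 + k) (by omega) (by omega)
      have h2 := mid (l - k) (by omega) (by omega)
      have h3 := pal (1 + k) (by omega) (by omega)
      have e1 : l + 1 - (1 + k) = l - k := by omega
      have e2 : i + l - k = i + (l - k) := by omega
      rw [e1] at h3
      rw [add_assoc, e2, h1, h2, h3]

theorem Irrational.int_sub_mul_inj {α : ℝ} (h : Irrational α) {m n p q : ℤ}
    (e : (p : ℝ) - m * α = q - n * α) : m = n ∧ p = q := by
  by_cases hmn : m = n
  · subst hmn
    exact ⟨rfl, by exact_mod_cast sub_left_injective e⟩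
  · exfalso
    have h0 : ((m - n : ℤ) : ℝ) ≠ 0 := by exact_mod_cast sub_ne_zero.2 hmn
    refine h ⟨((p - q : ℤ) : ℚ) / ((m - n : ℤ) : ℚ), ?_⟩
    push_cast at h0 ⊢
    rw [div_eq_iff h0]
    linarith

theorem Irrational.exists_mem_Ioo {α : ℝ} (h : Irrational α) (t : ℝ) {x y : ℝ} (hxy : x < y) :
    ∃ (m : ℕ) (p : ℤ), x < t + p - m * α ∧ t + p - m * α < y := by
  have hd : DenseRange (fun n : ℤ => n • (α : AddCircle (1 : ℝ))) :=
    AddCircle.denseRange_zsmul_coe_iff.2 (by simpa using h)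
  have hd' := denseRange_zsmul_iff_nsmul.1 hd
  have hopen : IsOpen ((fun s : ℝ => (s : AddCircle (1 : ℝ))) '' Set.Ioo (t - y) (t - x)) :=
    QuotientAddGroup.isOpenMap_coe _ isOpen_Ioo
  obtain ⟨n, s, hs, e⟩ := hd'.exists_mem_open hopen
    ((Set.nonempty_Ioo.2 (by linarith)).image _)
  have e1 : ((s - n * α : ℝ) : AddCircle (1 : ℝ)) = 0 := by
    rw [AddCircle.coe_sub, sub_eq_zero, ← nsmul_eq_mul, AddCircle.coe_nsmul]
    exact e
  obtain ⟨k, hk⟩ := (AddCircle.coe_eq_zero_iff (1 : ℝ)).1 e1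
  have hk' : (k : ℝ) = s - n * α := by simpa using hk
  refine ⟨n, -k, ?_, ?_⟩ <;> push_cast <;> linarith [hs.1, hs.2]

theorem Sturmian.exists_slope {w : ℕ → Bool} (hw : Sturmian w) :
    ∃ α : ℝ, ∀ i n, |(letterCount w true i n : ℝ) - n * α| ≤ 1 := by
  set c := letterCount w true with hc
  have lower : ∀ i j n k : ℕ, (k : ℤ) * (c i n - 1) ≤ c j (k * n) := by
    intro i j n k
    induction k with
    | zero => simp [hc]
    | succ k ih =>
      have h1 : c j ((k + 1) * n) = c j (k * n) + c (j + k * n) n := by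
        rw [add_one_mul]; exact letterCount_add ..
      have h2 := hw.letterCount_le n i (j + k * n)
      change c _ _ ≤ c _ _ + 1 at h2
      push_cast
      linarith
  have upper : ∀ j m k : ℕ, c j (k * m) ≤ (k : ℤ) * (c j m + 1) := by
    intro j m k
    induction k with
    | zero => simp [hc]
    | succ k ih =>
      have h1 : c j ((k + 1) * m) = c j (k * m) + c (j + k * m) m := by
        rw [add_one_mul]; exact letterCount_add ..
      have h2 := hw.letterCount_le m (j + k * m) j
      change c _ _ ≤ c _ _ + 1 at h2
      push_cast
      linarith
  let S : Set ℝ := {x | ∃ i n : ℕ, 0 < n ∧ x = ((c i n : ℝ) - 1) / n}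
  have bound : ∀ j m : ℕ, 0 < m → ∀ x ∈ S, x ≤ ((c j m : ℝ) + 1) / m := by
    rintro j m hm _ ⟨i, n, hn, rfl⟩
    rw [div_le_div_iff₀ (by exact_mod_cast hn) (by exact_mod_cast hm)]
    have h1 := lower i j n m
    have h2 := upper j m n
    rw [mul_comm n m] at h2
    have h3 := h1.trans h2
    have h4 : ((m : ℝ) * (c i n - 1)) ≤ n * (c j m + 1) := by exact_mod_cast h3
    linarith
  have hne : S.Nonempty := ⟨_, 0, 1, one_pos, rfl⟩
  have hbdd : BddAbove S := ⟨_, bound 0 1 one_pos⟩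
  refine ⟨sSup S, fun i n => ?_⟩
  rcases Nat.eq_zero_or_pos n with rfl | hn
  · simp [hc]
  · have hn' : (0 : ℝ) < n := by exact_mod_cast hn
    have h1 : ((c i n : ℝ) - 1) / n ≤ sSup S := le_csSup hbdd ⟨i, n, hn, rfl⟩
    have h2 : sSup S ≤ ((c i n : ℝ) + 1) / n := csSup_le hne (bound i n hn)
    rw [div_le_iff₀ hn'] at h1
    rw [le_div_iff₀ hn'] at h2
    rw [abs_le]
    constructor <;> linarith

theorem eventually_const_of_monotone_or_antitone {G : ℕ → ℤ} (hb : ∀ k, |G k| ≤ 1)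
    (hG : Monotone G ∨ Antitone G) : ∃ K, ∀ k ≥ K, G (k + 1) = G k := by
  have main : ∀ {G : ℕ → ℤ}, (∀ k, |G k| ≤ 1) → Monotone G → ∃ K, ∀ k ≥ K, G (k + 1) = G k := by
    intro G hb hG
    by_contra! h
    have : ∀ n : ℕ, ∃ k, (n : ℤ) - 1 ≤ G k := by
      intro n
      induction n with
      | zero => exact ⟨0, by have := abs_le.1 (hb 0); simp; omega⟩
      | succ n ih =>
        obtain ⟨k, hk⟩ := ih
        obtain ⟨k', hk', hne⟩ := h k
        have h1 := hG hk'
        have h2 := hG (Nat.le_succ k')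
        exact ⟨k' + 1, by push_cast; simp only [Nat.succ_eq_add_one] at h2; omega⟩
    obtain ⟨k, hk⟩ := this 3
    have := abs_le.1 (hb k)
    push_cast at hk
    omega
  rcases hG with hG | hG
  · exact main hb hG
  · obtain ⟨K, hK⟩ := main (G := fun k => -G k) (by simpa using hb) hG.neg
    exact ⟨K, fun k hk => neg_injective (hK k hk)⟩

theorem Sturmian.irrational_slope {w : ℕ → Bool} (hw : Sturmian w) {α : ℝ}
    (hα : ∀ i n, |(letterCount w true i n : ℝ) - n * α| ≤ 1) : Irrational α := by
  rintro ⟨x, rfl⟩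
  set c := letterCount w true with hc
  set q := x.den
  set p := x.num
  have hq : 0 < q := x.den_pos
  have hx : (q : ℝ) * (x : ℝ) = p := by
    exact_mod_cast Rat.den_mul_eq_num x
  have hG : ∀ r k : ℕ, |c r (k * q) - k * p| ≤ 1 := by
    intro r k
    have := hα r (k * q)
    push_cast at this
    rw [mul_assoc, hx] at this
    exact_mod_cast this
  have hstep : ∀ r k : ℕ, c r ((k + 1) * q) - ((k + 1 : ℕ) : ℤ) * p =
      c r (k * q) - k * p + (c (r + k * q) q - p) := by
    intro r k
    have h1 : c r ((k + 1) * q) = c r (k * q) + c (r + k * q) q := by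
      rw [add_one_mul]; exact letterCount_add ..
    rw [h1]
    push_cast
    ring
  have hsign : (∀ i, 0 ≤ c i q - p) ∨ ∀ i, c i q - p ≤ 0 := by
    by_contra! h
    obtain ⟨⟨i, hi⟩, j, hj⟩ := h
    have := hw.letterCount_le q j i
    change c _ _ ≤ c _ _ + 1 at this
    omega
  have hev : ∀ r : ℕ, ∃ K, ∀ k ≥ K, c (r + k * q) q = p := by
    intro r
    obtain ⟨K, hK⟩ := eventually_const_of_monotone_or_antitone (hG r) (hsign.imp
      (fun h => monotone_nat_of_le_succ fun k => by rw [hstep]; linarith [h (r + k * q)])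
      (fun h => antitone_nat_of_succ_le fun k => by rw [hstep]; linarith [h (r + k * q)]))
    refine ⟨K, fun k hk => ?_⟩
    have := hK k hk
    rw [hstep] at this
    linarith
  choose K hK using hev
  have hconst : ∀ i ≥ (∑ r ∈ Finset.range q, K r) * q, c i q = p := by
    intro i hi
    have h1 : K (i % q) ≤ ∑ r ∈ Finset.range q, K r :=
      Finset.single_le_sum (fun _ _ => Nat.zero_le _) (Finset.mem_range.2 (Nat.mod_lt i hq))
    have h2 := hK (i % q) (i / q) (h1.trans ((Nat.le_div_iff_mul_le hq).2 hi))
    rwa [Nat.mod_add_div'] at h2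
  refine hw.not_ultimatelyPeriodic
    ⟨(∑ r ∈ Finset.range q, K r) * q, q, hq, fun i hi => ?_⟩
  refine (letterCount_one_eq_iff (b := true)).1 ?_
  have h1 := hconst i hi
  have h2 := hconst (i + 1) (hi.trans (Nat.le_succ i))
  have h3 : c i (q + 1) = c i q + c (i + q) 1 := letterCount_add ..
  have h4 : c i (q + 1) = c i 1 + c (i + 1) q := by rw [add_comm q]; exact letterCount_add ..
  change c _ _ = c _ _
  omega

/-- The word `w` codes the rotation `z ↦ z - α` of the circle `[0, 1)`: the letter `b` is read
exactly where the rotation wraps around. -/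
structure IsRotationCoding (w : ℕ → Bool) (b : Bool) (α : ℝ) (z : ℕ → ℝ) : Prop where
  irrational : Irrational α
  nonneg : ∀ i, 0 ≤ z i
  lt_one : ∀ i, z i < 1
  add : ∀ i n, z (i + n) = z i + letterCount w b i n - n * α

theorem letterCount_false (w : ℕ → Bool) (i n : ℕ) :
    letterCount w false i n = n - letterCount w true i n := by
  have := List.count_not_add_count (factorAt w i n) true
  rw [factorAt_length] at this
  simp only [letterCount]
  simp only [Bool.not_true] at this
  omega

theorem Sturmian.exists_isRotationCoding {w : ℕ → Bool} (hw : Sturmian w) :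
    ∃ b α z, IsRotationCoding w b α z := by
  obtain ⟨α, hα⟩ := hw.exists_slope
  have irr := hw.irrational_slope hα
  set y : ℕ → ℝ := fun i => letterCount w true 0 i - i * α with hy
  have yadd : ∀ i n, y (i + n) = y i + letterCount w true i n - n * α := by
    intro i n
    simp only [hy, letterCount_add, zero_add]
    push_cast
    ring
  have yosc : ∀ i j, y i ≤ y j + 1 := by
    intro i j
    rcases le_total i j with h | h <;> obtain ⟨n, rfl⟩ := Nat.exists_eq_add_of_le h
    · linarith [yadd i n, (abs_le.1 (hα i n)).1]
    · linarith [yadd j n, (abs_le.1 (hα j n)).2]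
  have hbdd : BddBelow (Set.range y) := ⟨y 0 - 1, by rintro _ ⟨i, rfl⟩; linarith [yosc 0 i]⟩
  set a := sInf (Set.range y)
  have ha : ∀ i, a ≤ y i := fun i => csInf_le hbdd ⟨i, rfl⟩
  have ha' : ∀ i, y i ≤ a + 1 := fun i => by
    have : y i - 1 ≤ a :=
      le_csInf (Set.range_nonempty y) (by rintro _ ⟨j, rfl⟩; linarith [yosc i j])
    linarith
  by_cases htop : ∃ i, y i = a + 1
  · obtain ⟨i, hi⟩ := htop
    have hne : ∀ j, y j ≠ a := by
      intro j hj
      have e : ((letterCount w true 0 i : ℤ) : ℝ) - (i : ℤ) * α =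
          ((letterCount w true 0 j + 1 : ℤ) : ℝ) - (j : ℤ) * α := by
        have : y i = y j + 1 := by rw [hi, hj]
        simp only [hy] at this
        push_cast
        linarith
      obtain ⟨h1, -⟩ := irr.int_sub_mul_inj e
      obtain rfl : i = j := by exact_mod_cast h1
      linarith
    refine ⟨false, 1 - α, fun i => a + 1 - y i, ?_, fun i => by linarith [ha' i], fun i => ?_,
      fun i n => ?_⟩
    · simpa using irr.natCast_sub 1
    · linarith [lt_of_le_of_ne (ha i) (hne i).symm]
    · rw [yadd, letterCount_false]
      push_cast
      ring
  · push Not at htop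
    exact ⟨true, α, fun i => y i - a, irr, fun i => by linarith [ha i],
      fun i => by linarith [lt_of_le_of_ne (ha' i) (htop i)], fun i n => by rw [yadd]; ring⟩

/-- `m` is the least positive integer such that some `p - m * α` with `p : ℤ` lies in `(0, h)`. -/
structure IsLeastUp (α h : ℝ) (m : ℕ) (p : ℤ) : Prop where
  pos : 0 < m
  gap_pos : 0 < (p : ℝ) - m * α
  gap_lt : (p : ℝ) - m * α < h
  le : ∀ (m' : ℕ) (p' : ℤ), 0 < m' → 0 < (p' : ℝ) - m' * α → (p' : ℝ) - m' * α < h → m ≤ m'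

theorem exists_isLeastUp {α h : ℝ} (irr : Irrational α) (h0 : 0 < h) (h1 : h ≤ 1) :
    ∃ m p, IsLeastUp α h m p := by
  classical
  have hex : ∃ m : ℕ, 0 < m ∧ ∃ p : ℤ, 0 < (p : ℝ) - m * α ∧ (p : ℝ) - m * α < h := by
    obtain ⟨m, p, h2, h3⟩ := irr.exists_mem_Ioo 0 h0
    rw [zero_add] at h2 h3
    refine ⟨m, Nat.pos_of_ne_zero ?_, p, h2, h3⟩
    rintro rfl
    simp only [Nat.cast_zero, zero_mul, sub_zero] at h2 h3
    have h4 : (0 : ℤ) < p := by exact_mod_cast h2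
    have h5 : p < (1 : ℤ) := by exact_mod_cast h3.trans_le h1
    omega
  obtain ⟨hm, p, h2, h3⟩ := Nat.find_spec hex
  exact ⟨_, p, hm, h2, h3, fun m' p' h4 h5 h6 => Nat.find_min' hex ⟨h4, p', h5, h6⟩⟩

section Gaps

variable {α h : ℝ} {m₁ m₂ : ℕ} {p₁ p₂ : ℤ}

theorem IsLeastUp.le_gap_add_gap (h1 : h ≤ 1) (up : IsLeastUp α h m₁ p₁)
    (down : IsLeastUp (-α) h m₂ p₂) : h ≤ (p₁ - m₁ * α) + (p₂ - m₂ * -α) := by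
  by_contra! hlt
  have u := up.gap_pos
  have d := down.gap_pos
  rcases lt_trichotomy m₁ m₂ with hm | rfl | hm
  · obtain ⟨k, rfl⟩ := Nat.exists_eq_add_of_lt hm
    have := down.le (k + 1) (p₁ + p₂) (by omega) (by push_cast at *; linarith)
      (by push_cast at *; linarith)
    have := up.pos
    omega
  · have h2 : ((p₁ + p₂ : ℤ) : ℝ) < (1 : ℤ) := by push_cast; linarith
    have h3 : ((0 : ℤ) : ℝ) < (p₁ + p₂ : ℤ) := by push_cast; linarith
    rw [Int.cast_lt] at h2 h3
    omega
  · obtain ⟨k, rfl⟩ := Nat.exists_eq_add_of_lt hm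
    have := up.le (k + 1) (p₁ + p₂) (by omega) (by push_cast at *; linarith)
      (by push_cast at *; linarith)
    have := down.pos
    omega

theorem IsLeastUp.gap_add_gap_eq_iff (irr : Irrational α) (h1 : h ≤ 1)
    (up : IsLeastUp α h m₁ p₁) (down : IsLeastUp (-α) h m₂ p₂) {n : ℕ} {k : ℤ}
    (hk : h = k + n * α) :
    (p₁ - m₁ * α) + (p₂ - m₂ * -α) = h ↔
      ∀ (j : ℕ) (p : ℤ), 0 < j → j < n → ¬(0 < p + j * α ∧ p + j * α < h) := by
  have u := up.gap_pos
  have d := down.gap_pos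
  have u' := up.gap_lt
  have d' := down.gap_lt
  constructor
  · rintro e j p hj hjn ⟨h2, h3⟩
    obtain ⟨h4, -⟩ := irr.int_sub_mul_inj (m := (m₁ : ℤ) - m₂) (n := -(n : ℤ)) (p := p₁ + p₂)
      (q := k) (by push_cast; linarith)
    have := down.le j p hj (by linarith) (by linarith)
    omega
  · intro H
    have hlt : n < m₂ := by
      by_contra! hle
      rcases hle.lt_or_eq with hlt | rfl
      · exact H m₂ p₂ down.pos hlt ⟨by linarith, by linarith⟩
      · have h2 : ((0 : ℤ) : ℝ) < (k - p₂ : ℤ) := by push_cast; linarith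
        have h3 : ((k - p₂ : ℤ) : ℝ) < (1 : ℤ) := by push_cast; linarith
        rw [Int.cast_lt] at h2 h3
        omega
    have h2 : m₁ ≤ m₂ - n := up.le (m₂ - n) (k - p₂) (by omega)
      (by rw [Nat.cast_sub hlt.le]; push_cast; linarith)
      (by rw [Nat.cast_sub hlt.le]; push_cast; linarith)
    have h3 : m₂ ≤ n + m₁ := down.le (n + m₁) (k - p₁) (by have := up.pos; omega)
      (by push_cast; linarith) (by push_cast; linarith)
    obtain rfl : m₂ = n + m₁ := by omega
    push_cast at d d' ⊢
    have h4 : ((p₁ + p₂ - k : ℤ) : ℝ) < (1 : ℤ) := by push_cast; linarith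
    have h5 : ((-1 : ℤ) : ℝ) < (p₁ + p₂ - k : ℤ) := by push_cast; linarith
    rw [Int.cast_lt] at h4 h5
    have h6 : k = p₁ + p₂ := by omega
    rw [hk, h6]
    push_cast
    ring

theorem IsLeastUp.notMem_of_between (irr : Irrational α) {z : ℕ → ℝ} {c : ℕ → ℕ → ℤ}
    (hz : ∀ i n, z (i + n) = z i + c i n - n * α) {O : Set ℕ}
    (hO : ∀ i ∈ O, ∀ k ∈ O, z k - z i < h) (up : IsLeastUp α h m₁ p₁) {i : ℕ} (hi : i ∈ O)
    (hi' : i + m₁ ∈ O) (hc : c i m₁ = p₁) {k : ℕ} (hk : i < k) (hk' : k < i + m₁) : k ∉ O := by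
  intro hkO
  obtain ⟨m, rfl⟩ := Nat.exists_eq_add_of_le hk.le
  have e := hz i m
  have e' := hz i m₁
  rw [hc] at e'
  rcases lt_trichotomy (z (i + m)) (z i) with ht | ht | ht
  · have h1 := hO _ hkO _ hi'
    have := up.le (m₁ - m) (p₁ - c i m) (by omega)
      (by rw [Nat.cast_sub (by omega)]; push_cast; linarith [up.gap_pos])
      (by rw [Nat.cast_sub (by omega)]; push_cast; linarith)
    omega
  · obtain ⟨h1, -⟩ := irr.int_sub_mul_inj (m := (m : ℤ)) (n := 0) (p := c i m) (q := 0)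
      (by push_cast; linarith)
    omega
  · have h1 := hO _ hi _ hkO
    have := up.le m (c i m) (by omega) (by linarith) (by linarith)
    omega

end Gaps

namespace IsRotationCoding

variable {w : ℕ → Bool} {b : Bool} {α : ℝ} {z : ℕ → ℝ}

theorem letterCount_eq (hz : IsRotationCoding w b α z) {i m : ℕ} {p : ℤ}
    (h0 : 0 ≤ z i + p - m * α) (h1 : z i + p - m * α < 1) : letterCount w b i m = p := by
  have e := hz.add i m
  have h2 := hz.nonneg (i + m)
  have h3 := hz.lt_one (i + m)
  have h4 : ((letterCount w b i m - p : ℤ) : ℝ) < (1 : ℤ) := by push_cast; linarith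
  have h5 : ((-1 : ℤ) : ℝ) < (letterCount w b i m - p : ℤ) := by push_cast; linarith
  rw [Int.cast_lt] at h4 h5
  omega

theorem exists_mem_Ioo (hz : IsRotationCoding w b α z) {x y : ℝ} (hx : 0 ≤ x) (hxy : x < y)
    (hy : y ≤ 1) (N : ℕ) : ∃ i ≥ N, x < z i ∧ z i < y := by
  obtain ⟨m, p, h1, h2⟩ := hz.irrational.exists_mem_Ioo (z N) hxy
  have e := hz.letterCount_eq (i := N) (m := m) (p := p) (by linarith) (by linarith)
  have e' := hz.add N m
  rw [e] at e'
  exact ⟨N + m, by omega, by linarith, by linarith⟩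

theorem eq_letter_iff (hz : IsRotationCoding w b α z) (i : ℕ) : w i = b ↔ z i < α := by
  have e := hz.add i 1
  rw [letterCount_one] at e
  have h0 := hz.nonneg (i + 1)
  have h1 := hz.lt_one (i + 1)
  split_ifs at e with h
  · push_cast at e
    exact ⟨fun _ => by linarith, fun _ => h⟩
  · push_cast at e
    exact ⟨fun h' => absurd h' h, fun h' => by linarith⟩

/-- The abelian occurrences of `u` are the visits to an interval `[l, l + h)`: then `u` is singular
iff no point `p + j * α` with `0 < j < u.length` is interior to it. -/
theorem singular_iff (hz : IsRotationCoding w b α z) {u : List Bool} (hu : IsFactor w u)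
    {l h : ℝ} (hl : 0 ≤ l) (hlh : l + h ≤ 1)
    (hO : ∀ i, i ∈ AbelianOccurrences w u ↔ l ≤ z i ∧ z i < l + h) :
    Singular w u ↔ ∀ (j : ℕ) (p : ℤ), 0 < j → j < u.length →
      ¬(l < p + j * α ∧ p + j * α < l + h) := by
  set n := u.length with hn
  constructor
  · rintro hs j p - hjn ⟨h1, h2⟩
    obtain ⟨i, -, hi1, hi2⟩ := hz.exists_mem_Ioo hl h1 (by linarith) 0
    obtain ⟨i', -, hi1', hi2'⟩ := hz.exists_mem_Ioo (by linarith) h2 hlh 0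
    have word : ∀ i, l ≤ z i → z i < l + h → factorAt w i n = u := fun i h1 h2 =>
      hs _ ⟨i, by rw [factorAt_length]⟩ ((hO i).2 ⟨h1, h2⟩)
    have e := (word i hi1.le (by linarith)).trans (word i' (by linarith) hi2').symm
    have e' : factorAt w i j = factorAt w i' j :=
      factorAt_eq_iff.2 fun k hk => factorAt_eq_iff.1 e k (hk.trans hjn)
    have c1 := hz.letterCount_eq (i := i) (m := j) (p := 1 - p) (by push_cast; linarith)
      (by push_cast; linarith)
    have c2 := hz.letterCount_eq (i := i') (m := j) (p := -p) (by push_cast; linarith)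
      (by push_cast; linarith)
    have c3 : letterCount w b i j = letterCount w b i' j := by simp only [letterCount, e']
    omega
  · rintro H v ⟨i, hv⟩ hvu
    obtain ⟨i', hu'⟩ := hu
    have hlen : v.length = n := hvu.length_eq
    rw [hlen] at hv
    rw [← hn] at hu'
    by_contra hne
    have hex : ∃ k, k < n ∧ w (i + k) ≠ w (i' + k) := by
      by_contra! h
      exact hne (hv.symm.trans ((factorAt_eq_iff.2 h).trans hu'))
    classical
    obtain ⟨hk, hkw⟩ := Nat.find_spec hex
    have hmin : ∀ k' < Nat.find hex, w (i + k') = w (i' + k') := fun k' hk' => by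
      by_contra h
      exact Nat.find_min hex hk' ⟨hk'.trans hk, h⟩
    generalize Nat.find hex = k at hk hkw hmin
    have hcount : letterCount w b i k = letterCount w b i' k := by
      simp only [letterCount, factorAt_eq_iff.2 hmin]
    have hcount' : letterCount w b i n = letterCount w b i' n := by
      simp only [letterCount, hv, hu']
      exact_mod_cast hvu.count_eq b
    have hkn : k + 1 < n := by
      by_contra! h
      have h' : n = k + 1 := by omega
      rw [h', letterCount_add, letterCount_add, hcount, add_right_inj] at hcount'
      exact hkw (letterCount_one_eq_iff.1 hcount')
    have hi := (hO i).1 (show List.Perm _ _ by rw [← hn, hv]; exact hvu)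
    have hi' := (hO i').1 (show List.Perm _ _ by rw [← hn, hu'])
    have e := hz.add i k
    have e' := hz.add i' k
    have hw := hz.eq_letter_iff (i + k)
    have hw' := hz.eq_letter_iff (i' + k)
    have hb : w (i + k) = b ∧ w (i' + k) ≠ b ∨ w (i' + k) = b ∧ w (i + k) ≠ b := by
      revert hkw
      cases w (i + k) <;> cases w (i' + k) <;> cases b <;> simp
    refine H (k + 1) (-letterCount w b i k) (by omega) hkn ?_
    rw [← hcount] at e'
    push_cast
    rcases hb with ⟨h1, h2⟩ | ⟨h1, h2⟩
    · rw [hw] at h1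
      rw [Ne, hw', not_lt] at h2
      constructor <;> linarith
    · rw [hw'] at h1
      rw [Ne, hw, not_lt] at h2
      constructor <;> linarith

end IsRotationCoding

theorem coe_factorAt_eq_iff {w : ℕ → Bool} {b : Bool} {i j m n : ℕ} :
    (factorAt w i m : Multiset Bool) = factorAt w j n ↔
      m = n ∧ letterCount w b i m = letterCount w b j n := by
  rw [Multiset.coe_eq_coe]
  constructor
  · intro h
    have := h.length_eq
    rw [factorAt_length, factorAt_length] at this
    exact ⟨this, by simp only [letterCount, h.count_eq]⟩
  · rintro ⟨rfl, h⟩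
    rw [perm_iff_count_eq (by simp [factorAt_length]) b]
    exact Nat.cast_injective (R := ℤ) h

theorem mem_abelianReturnClasses_of_next {w : ℕ → Bool} {u : List Bool} {i m : ℕ} (hm : 0 < m)
    (hi : i ∈ AbelianOccurrences w u) (hj : i + m ∈ AbelianOccurrences w u)
    (hn : ∀ k, i < k → k < i + m → k ∉ AbelianOccurrences w u) :
    (factorAt w i m : Multiset Bool) ∈ abelianReturnClasses w u :=
  ⟨_, ⟨i, i + m, hi, hj, by omega, hn, rfl⟩, by rw [Nat.add_sub_cancel_left]⟩

namespace IsRotationCoding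

variable {w : ℕ → Bool} {b : Bool} {α : ℝ} {z : ℕ → ℝ} {u : List Bool} {l h : ℝ}
  {m₁ m₂ : ℕ} {p₁ p₂ : ℤ}

theorem return_up (hz : IsRotationCoding w b α z) (hl : 0 ≤ l) (hlh : l + h ≤ 1)
    (hO : ∀ i, i ∈ AbelianOccurrences w u ↔ l ≤ z i ∧ z i < l + h)
    (up : IsLeastUp α h m₁ p₁) {i : ℕ} (hi : l ≤ z i) (hi' : z i + (p₁ - m₁ * α) < l + h) :
    i + m₁ ∈ AbelianOccurrences w u ∧ (∀ k, i < k → k < i + m₁ → k ∉ AbelianOccurrences w u) ∧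
      letterCount w b i m₁ = p₁ := by
  have g := up.gap_pos
  have c := hz.letterCount_eq (i := i) (m := m₁) (p := p₁) (by linarith) (by linarith)
  have e := hz.add i m₁
  rw [c] at e
  have hmem : i + m₁ ∈ AbelianOccurrences w u := (hO _).2 ⟨by linarith, by linarith⟩
  refine ⟨hmem, fun k h1 h2 => up.notMem_of_between hz.irrational hz.add ?_
    ((hO i).2 ⟨hi, by linarith⟩) hmem c h1 h2, c⟩
  intro x hx y hy
  linarith [((hO x).1 hx).1, ((hO y).1 hy).2]

theorem return_down (hz : IsRotationCoding w b α z) (hl : 0 ≤ l) (hlh : l + h ≤ 1)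
    (hO : ∀ i, i ∈ AbelianOccurrences w u ↔ l ≤ z i ∧ z i < l + h)
    (down : IsLeastUp (-α) h m₂ p₂) {i : ℕ} (hi : l ≤ z i - (p₂ - m₂ * -α))
    (hi' : z i < l + h) :
    i + m₂ ∈ AbelianOccurrences w u ∧ (∀ k, i < k → k < i + m₂ → k ∉ AbelianOccurrences w u) ∧
      letterCount w b i m₂ = -p₂ := by
  have g := down.gap_pos
  have c := hz.letterCount_eq (i := i) (m := m₂) (p := -p₂) (by push_cast; linarith)
    (by push_cast; linarith)
  have e := hz.add i m₂
  rw [c] at e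
  push_cast at e
  have hmem : i + m₂ ∈ AbelianOccurrences w u := (hO _).2 ⟨by linarith, by linarith⟩
  refine ⟨hmem, fun k h1 h2 => down.notMem_of_between hz.irrational.neg (z := fun i => -z i)
    (c := fun i n => -letterCount w b i n) (fun i n => ?_) ?_
    ((hO i).2 ⟨by linarith, hi'⟩) hmem (by rw [c, neg_neg]) h1 h2, c⟩
  · simp only [hz.add i n]
    push_cast
    ring
  · intro x hx y hy
    linarith [((hO x).1 hx).2, ((hO y).1 hy).1]

/-- If the abelian occurrences of `u` are the visits to `[l, l + h)`, then `u` has exactly two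
abelian returns iff the two shortest translations by which one can return add up to `h`. -/
theorem encard_eq_two_iff (hz : IsRotationCoding w b α z) (hl : 0 ≤ l) (hlh : l + h ≤ 1)
    (hO : ∀ i, i ∈ AbelianOccurrences w u ↔ l ≤ z i ∧ z i < l + h)
    (up : IsLeastUp α h m₁ p₁) (down : IsLeastUp (-α) h m₂ p₂) :
    (abelianReturnClasses w u).encard = 2 ↔ (p₁ - m₁ * α) + (p₂ - m₂ * -α) = h := by
  have g₁ := up.gap_pos
  have g₁' := up.gap_lt
  have g₂ := down.gap_pos
  have g₂' := down.gap_lt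
  obtain ⟨x, -, hx, hx'⟩ := hz.exists_mem_Ioo (x := l) (y := l + h - (p₁ - m₁ * α)) hl
    (by linarith) (by linarith) 0
  obtain ⟨y, -, hy, hy'⟩ := hz.exists_mem_Ioo (x := l + (p₂ - m₂ * -α)) (y := l + h) (by linarith)
    (by linarith) hlh 0
  obtain ⟨hx1, hx2, hx3⟩ := hz.return_up hl hlh hO up hx.le (by linarith)
  obtain ⟨hy1, hy2, hy3⟩ := hz.return_down hl hlh hO down (by linarith) hy'
  have hA := mem_abelianReturnClasses_of_next up.pos ((hO x).2 ⟨by linarith, by linarith⟩) hx1 hx2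
  have hB := mem_abelianReturnClasses_of_next down.pos ((hO y).2 ⟨by linarith, by linarith⟩) hy1 hy2
  have hAB : (factorAt w x m₁ : Multiset Bool) ≠ factorAt w y m₂ := by
    rw [Ne, coe_factorAt_eq_iff (b := b), hx3, hy3]
    rintro ⟨rfl, rfl⟩
    push_cast at g₁
    linarith
  constructor
  · intro hcard
    by_contra hne
    have hgt := lt_of_le_of_ne (up.le_gap_add_gap (by linarith) down) (Ne.symm hne)
    obtain ⟨i, -, hi, hi'⟩ := hz.exists_mem_Ioo (x := l + h - (p₁ - m₁ * α))
      (y := l + (p₂ - m₂ * -α)) (by linarith) (by linarith) (by linarith) 0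
    have hiO := (hO i).2 ⟨by linarith, by linarith⟩
    have hex : ∃ m, 0 < m ∧ i + m ∈ AbelianOccurrences w u := by
      obtain ⟨j, hj, h1, h2⟩ := hz.exists_mem_Ioo hl (by linarith : l < l + h) hlh (i + 1)
      exact ⟨j - i, by omega, by rw [Nat.add_sub_cancel' (by omega)]; exact (hO j).2 ⟨h1.le, h2⟩⟩
    classical
    obtain ⟨hm, hmO⟩ := Nat.find_spec hex
    have hmin : ∀ k, i < k → k < i + Nat.find hex → k ∉ AbelianOccurrences w u := by
      intro k h1 h2 hk
      refine Nat.find_min hex (m := k - i) (by omega) ⟨by omega, ?_⟩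
      rwa [Nat.add_sub_cancel' h1.le]
    generalize Nat.find hex = m at hm hmO hmin
    have hC := mem_abelianReturnClasses_of_next hm hiO hmO hmin
    have e := hz.add i m
    have hm' := (hO _).1 hmO
    have hCA : (factorAt w i m : Multiset Bool) ≠ factorAt w x m₁ := by
      rw [Ne, coe_factorAt_eq_iff (b := b), hx3]
      rintro ⟨rfl, h1⟩
      rw [h1] at e
      linarith
    have hCB : (factorAt w i m : Multiset Bool) ≠ factorAt w y m₂ := by
      rw [Ne, coe_factorAt_eq_iff (b := b), hy3]
      rintro ⟨rfl, h1⟩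
      rw [h1] at e
      push_cast at e
      linarith
    obtain ⟨a, a', -, hS⟩ := Set.encard_eq_two.1 hcard
    rw [hS] at hA hB hC
    rcases hA with hA | hA <;> rcases hB with hB | hB <;> rcases hC with hC | hC <;>
      first
      | exact hAB (hA.trans hB.symm)
      | exact hCA (hC.trans hA.symm)
      | exact hCB (hC.trans hB.symm)
  · intro heq
    refine Set.encard_eq_two.2 ⟨_, _, hAB, Set.Subset.antisymm ?_ ?_⟩
    · rintro _ ⟨_, ⟨i, j, hi, hj, hij, hnext, rfl⟩, rfl⟩
      have hi' := (hO i).1 hi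
      have unique : ∀ m, 0 < m → i + m ∈ AbelianOccurrences w u →
          (∀ k, i < k → k < i + m → k ∉ AbelianOccurrences w u) → j - i = m := by
        intro m hm h1 h2
        rcases lt_trichotomy j (i + m) with h | h | h
        · exact absurd hj (h2 j hij h)
        · omega
        · exact absurd h1 (hnext _ (by omega) h)
      rcases lt_or_ge (z i) (l + h - (p₁ - m₁ * α)) with hlt | hge
      · obtain ⟨h1, h2, h3⟩ := hz.return_up hl hlh hO up hi'.1 (by linarith)
        left
        simp only [unique _ up.pos h1 h2]
        exact (coe_factorAt_eq_iff (b := b)).2 ⟨rfl, h3.trans hx3.symm⟩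
      · obtain ⟨h1, h2, h3⟩ := hz.return_down hl hlh hO down (by linarith) hi'.2
        right
        simp only [unique _ down.pos h1 h2]
        exact (coe_factorAt_eq_iff (b := b)).2 ⟨rfl, h3.trans hy3.symm⟩
    · rintro _ (rfl | rfl)
      exacts [hA, hB]

theorem mem_abelianOccurrences_iff (hz : IsRotationCoding w b α z) {i₀ i : ℕ}
    (hu : factorAt w i₀ u.length = u) :
    i ∈ AbelianOccurrences w u ↔ 0 ≤ z i + (letterCount w b i₀ u.length - u.length * α) ∧
      z i + (letterCount w b i₀ u.length - u.length * α) < 1 := by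
  have hmem : i ∈ AbelianOccurrences w u ↔
      letterCount w b i u.length = letterCount w b i₀ u.length := by
    rw [AbelianOccurrences, Set.mem_ofPred_eq, perm_iff_count_eq (factorAt_length _ _ _) b]
    simp only [letterCount, hu, Nat.cast_inj]
  rw [hmem]
  constructor
  · intro e
    have h1 := hz.add i u.length
    rw [e] at h1
    constructor <;> linarith [hz.nonneg (i + u.length), hz.lt_one (i + u.length)]
  · rintro ⟨h1, h2⟩
    exact hz.letterCount_eq (by linarith) (by linarith)

theorem encard_eq_two_iff_singular (hz : IsRotationCoding w b α z) (hu : IsFactor w u) :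
    (abelianReturnClasses w u).encard = 2 ↔ Singular w u := by
  obtain ⟨i₀, hi₀⟩ := id hu
  have hmem := fun i => hz.mem_abelianOccurrences_iff (i := i) hi₀
  have e := hz.add i₀ u.length
  have b1 := hz.nonneg i₀
  have b2 := hz.lt_one i₀
  have b3 := hz.nonneg (i₀ + u.length)
  have b4 := hz.lt_one (i₀ + u.length)
  set n := u.length
  set c := letterCount w b i₀ n
  rcases le_or_gt 0 ((c : ℝ) - n * α) with hd | hd
  · obtain ⟨h, hh⟩ : ∃ h : ℝ, h = 1 - (c - n * α) := ⟨_, rfl⟩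
    have hO : ∀ i, i ∈ AbelianOccurrences w u ↔ 0 ≤ z i ∧ z i < 0 + h := fun i => by
      rw [hmem]
      have := hz.nonneg i
      constructor <;> rintro ⟨h1, h2⟩ <;> constructor <;> linarith
    obtain ⟨m₁, p₁, up⟩ := exists_isLeastUp (h := h) hz.irrational (by linarith) (by linarith)
    obtain ⟨m₂, p₂, down⟩ :=
      exists_isLeastUp (h := h) hz.irrational.neg (by linarith) (by linarith)
    rw [hz.encard_eq_two_iff le_rfl (by linarith) hO up down,
      hz.singular_iff hu le_rfl (by linarith) hO,
      up.gap_add_gap_eq_iff hz.irrational (by linarith) down (n := n) (k := 1 - c)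
        (by push_cast; linarith)]
    simp only [zero_add]
    rfl
  · obtain ⟨h, hh⟩ : ∃ h : ℝ, h = 1 + (c - n * α) := ⟨_, rfl⟩
    have hO : ∀ i, i ∈ AbelianOccurrences w u ↔ 1 - h ≤ z i ∧ z i < 1 - h + h := fun i => by
      rw [hmem]
      have := hz.lt_one i
      constructor <;> rintro ⟨h1, h2⟩ <;> constructor <;> linarith
    obtain ⟨m₁, p₁, up⟩ := exists_isLeastUp (h := h) hz.irrational (by linarith) (by linarith)
    obtain ⟨m₂, p₂, down⟩ :=
      exists_isLeastUp (h := h) hz.irrational.neg (by linarith) (by linarith)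
    have up' : IsLeastUp (- -α) h m₁ p₁ := by rwa [neg_neg]
    have key := down.gap_add_gap_eq_iff hz.irrational.neg (by linarith) up' (n := n)
      (k := 1 + c) (by push_cast; linarith)
    rw [neg_neg, add_comm] at key
    rw [hz.encard_eq_two_iff (by linarith) (by linarith) hO up down, key,
      hz.singular_iff hu (by linarith) (by linarith) hO]
    constructor
    · rintro H j p h1 h2 ⟨h3, h4⟩
      exact H j (1 - p) h1 h2 ⟨by push_cast; linarith, by push_cast; linarith⟩
    · rintro H j p h1 h2 ⟨h3, h4⟩
      exact H j (1 - p) h1 h2 ⟨by push_cast; linarith, by push_cast; linarith⟩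

end IsRotationCoding

/-- A factor of a Sturmian word has exactly two abelian returns if and
only if it is singular. -/
theorem sturmian_two_abelian_returns_iff_singular (w : ℕ → Bool) (hw : Sturmian w)
    (u : List Bool) (hu : IsFactor w u) :
    (abelianReturnClasses w u).encard = 2 ↔ Singular w u := by
  obtain ⟨b, α, z, hz⟩ := hw.exists_isRotationCoding
  exact hz.encard_eq_two_iff_singular hu
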